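/- arXiv:2003.11174 — 4 statements merged into one kernel-verified Lean document; each statement's English description precedes it below -/
import Mathlib

section
/- With the index set T = {a_i : 1≤i≤K} ∪ {a_{i,j} : 1≤i,j≤K} ∪ {d_i : 1≤i≤K} (so T has 2K + K² elements), define the T×T real matrix M by: M(a_i, a_{j,i}) = λ_{j,i}/λ_i for all 1≤i,j≤K; M(a_{i,j}, d_i) = P_{i,j} for all 1≤i,j≤K; M(d_i, a_i) = w_i for all 1≤i≤K; and all other entries equal to 0. Then the matrix E − M is invertible, where E is the T×T identity matrix; consequently, for every vector b indexed by T, the linear system (E − M) x = b has the unique solution x = (E − M)^{-1} b. -/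
open Matrix

/-- The index set `T` for the IDC equation system: `a_i` (total arrival flows),
`a_{i,j}` (internal split flows), and `d_i` (departure flows). -/
abbrev IDCIndex (K : ℕ) := Fin K ⊕ (Fin K × Fin K) ⊕ Fin K

/-- The coefficient matrix `M` of the IDC equation system:
`M(a_i, a_{j,i}) = λ_{j,i}/λ_i`, `M(a_{i,j}, d_i) = P_{i,j}`, `M(d_i, a_i) = w_i`,
and all other entries are `0`. -/
noncomputable def IDCMatrix (K : ℕ) (P : Matrix (Fin K) (Fin K) ℝ)
    (lam w : Fin K → ℝ) : Matrix (IDCIndex K) (IDCIndex K) ℝ :=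
  fun r c =>
    match r, c with
    | Sum.inl i, Sum.inr (Sum.inl (j, i')) => if i' = i then lam j * P j i / lam i else 0
    | Sum.inr (Sum.inl (i, j)), Sum.inr (Sum.inr i') =>
        if i' = i then P i j else 0
    | Sum.inr (Sum.inr i), Sum.inl i' => if i' = i then w i else 0
    | _, _ => 0

/-- A nonnegative vector that is subinvariant under the transpose of a substochastic matrix `P`
vanishes when `1 - Pᵀ` is invertible. -/
theorem eq_zero_of_le_transpose_mulVec {n : Type*} [Fintype n] [DecidableEq n]
    {P : Matrix n n ℝ} (hProw : ∀ i, ∑ j, P i j ≤ 1) (hInv : IsUnit (1 - Pᵀ))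
    {u : n → ℝ} (hu : 0 ≤ u) (hle : u ≤ Pᵀ *ᵥ u) : u = 0 := by
  have hsum : ∑ i, (Pᵀ *ᵥ u) i ≤ ∑ i, u i := by
    simp only [mulVec, dotProduct, transpose_apply]
    rw [Finset.sum_comm]
    refine Finset.sum_le_sum fun j _ => ?_
    rw [← Finset.sum_mul]
    exact mul_le_of_le_one_left (hu j) (hProw j)
  have hfix : u = Pᵀ *ᵥ u := by
    have h := (Finset.sum_eq_sum_iff_of_le fun i _ => hle i).1
      (le_antisymm (Finset.sum_le_sum fun i _ => hle i) hsum)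
    exact funext fun i => h i (Finset.mem_univ i)
  apply mulVec_injective_iff_isUnit.2 hInv
  rw [sub_mulVec, one_mulVec, mulVec_zero, ← hfix, sub_self]

/-- The vector `λ_i x(a_i)` attached to a solution `x` of `x = M x` satisfies
`λ_i x(a_i) = ∑ j, P_{j,i} ^ 2 w_j λ_j x(a_j)`. -/
theorem IDCMatrix.mul_inl_eq_sum {K : ℕ} {P : Matrix (Fin K) (Fin K) ℝ} {lam w : Fin K → ℝ}
    (hlam : ∀ i, lam i ≠ 0) {x : IDCIndex K → ℝ} (hx : x = IDCMatrix K P lam w *ᵥ x)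
    (i : Fin K) :
    lam i * x (Sum.inl i) = ∑ j, P j i ^ 2 * w j * (lam j * x (Sum.inl j)) := by
  have hd (j : Fin K) : x (Sum.inr (Sum.inr j)) = w j * x (Sum.inl j) := by
    have h := congrFun hx (Sum.inr (Sum.inr j))
    simpa [mulVec, dotProduct, IDCMatrix] using h
  have hs (j k : Fin K) : x (Sum.inr (Sum.inl (j, k))) = P j k * x (Sum.inr (Sum.inr j)) := by
    have h := congrFun hx (Sum.inr (Sum.inl (j, k)))
    simpa [mulVec, dotProduct, IDCMatrix] using h
  have ha : x (Sum.inl i) = ∑ j, lam j * P j i / lam i * x (Sum.inr (Sum.inl (j, i))) := by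
    have h := congrFun hx (Sum.inl i)
    simpa [mulVec, dotProduct, IDCMatrix, Fintype.sum_prod_type] using h
  rw [ha, Finset.mul_sum]
  refine Finset.sum_congr rfl fun j _ => ?_
  rw [hs, hd]
  have := hlam i
  field_simp

/-- The equation `x = M x` has only the trivial solution. -/
theorem IDCMatrix.eq_zero_of_eq_mulVec {K : ℕ} {P : Matrix (Fin K) (Fin K) ℝ}
    {lam w : Fin K → ℝ} (hPnonneg : ∀ i j, 0 ≤ P i j) (hProw : ∀ i, ∑ j, P i j ≤ 1)
    (hInv : IsUnit (1 - Pᵀ)) (hlam : ∀ i, lam i ≠ 0) (hw : ∀ i, 0 ≤ w i ∧ w i ≤ 1)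
    {x : IDCIndex K → ℝ} (hx : x = IDCMatrix K P lam w *ᵥ x) : x = 0 := by
  have hu : (fun i => |lam i * x (Sum.inl i)|) = 0 := by
    refine eq_zero_of_le_transpose_mulVec hProw hInv (fun i => abs_nonneg _) fun i => ?_
    simp only [mulVec, dotProduct, transpose_apply]
    rw [IDCMatrix.mul_inl_eq_sum hlam hx i]
    refine (Finset.abs_sum_le_sum_abs _ _).trans (Finset.sum_le_sum fun j _ => ?_)
    have hP1 : P j i ≤ 1 :=
      (Finset.single_le_sum (fun k _ => hPnonneg j k) (Finset.mem_univ i)).trans (hProw j)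
    have hP2 : P j i ^ 2 * w j ≤ P j i :=
      (mul_le_of_le_one_right (sq_nonneg _) (hw j).2).trans
        (pow_le_of_le_one (hPnonneg j i) hP1 two_ne_zero)
    rw [abs_mul, abs_of_nonneg (mul_nonneg (sq_nonneg _) (hw j).1)]
    exact mul_le_mul_of_nonneg_right hP2 (abs_nonneg _)
  have ha (i : Fin K) : x (Sum.inl i) = 0 := by
    simpa [hlam i] using congrFun hu i
  have hd (j : Fin K) : x (Sum.inr (Sum.inr j)) = 0 := by
    rw [hx]
    simp [mulVec, dotProduct, IDCMatrix, ha]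
  ext (i | ⟨j, k⟩ | j)
  · exact ha i
  · rw [hx]
    simp [mulVec, dotProduct, IDCMatrix, hd]
  · exact hd j

theorem idc_matrix_one_sub_invertible
    (K : ℕ) (hK : 0 < K)
    (P : Matrix (Fin K) (Fin K) ℝ)
    (hPnonneg : ∀ i j, 0 ≤ P i j)
    (hProw : ∀ i, ∑ j, P i j ≤ 1)
    (hInv : IsUnit (1 - Pᵀ))
    (lam0 : Fin K → ℝ) (hlam0 : ∀ i, 0 ≤ lam0 i)
    (lam : Fin K → ℝ) (hlam : lam = (1 - Pᵀ)⁻¹ *ᵥ lam0)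
    (hlampos : ∀ i, 0 < lam i)
    (w : Fin K → ℝ) (hw : ∀ i, 0 ≤ w i ∧ w i ≤ 1) :
    IsUnit (1 - IDCMatrix K P lam w) ∧
      ∀ b : IDCIndex K → ℝ, ∀ x : IDCIndex K → ℝ,
        (1 - IDCMatrix K P lam w) *ᵥ x = b ↔
          x = (1 - IDCMatrix K P lam w)⁻¹ *ᵥ b := by
  have hunit : IsUnit (1 - IDCMatrix K P lam w) := by
    rw [← mulVec_injective_iff_isUnit]
    refine (injective_iff_map_eq_zero (mulVecLin (1 - IDCMatrix K P lam w))).2 fun x hx => ?_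
    rw [mulVecLin_apply, sub_mulVec, one_mulVec, sub_eq_zero] at hx
    exact IDCMatrix.eq_zero_of_eq_mulVec hPnonneg hProw hInv (fun i => (hlampos i).ne') hw hx
  have hdet := (isUnit_iff_isUnit_det _).1 hunit
  refine ⟨hunit, fun b x => ⟨?_, ?_⟩⟩
  · rintro rfl
    rw [mulVec_mulVec, nonsing_inv_mul _ hdet, one_mulVec]
  · rintro rfl
    rw [mulVec_mulVec, mul_nonsing_inv _ hdet, one_mulVec]
end

section
/- The K×K real matrix C with entries C_{i,j} = λ_j P_{j,i}² w_j / λ_i (the coefficient matrix obtained by substituting the departure and splitting equations into the superposition equation of the IDC equation system) satisfies: I − C is invertible, where I is the K×K identity matrix. -/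
open Matrix

/-- For a substochastic `P` with `1 - Pᵀ` invertible, the only vector whose absolute value is
entrywise dominated by its image under `Pᵀ` is zero. -/
theorem eq_zero_of_abs_le_transpose_mulVec_abs {ι : Type*} [Fintype ι] [DecidableEq ι]
    {P : Matrix ι ι ℝ} (hrow : ∀ i, ∑ j, P i j ≤ 1) (hinv : IsUnit (1 - Pᵀ))
    {u : ι → ℝ} (hu : ∀ i, |u i| ≤ (Pᵀ *ᵥ fun j => |u j|) i) : u = 0 := by
  have hsum : ∑ i, (Pᵀ *ᵥ fun j => |u j|) i ≤ ∑ i, |u i| := by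
    simp only [mulVec, dotProduct, transpose_apply]
    rw [Finset.sum_comm]
    refine Finset.sum_le_sum fun j _ => ?_
    rw [← Finset.sum_mul]
    exact mul_le_of_le_one_left (abs_nonneg _) (hrow j)
  have heq : ∀ i, |u i| = (Pᵀ *ᵥ fun j => |u j|) i := fun i =>
    (Finset.sum_eq_sum_iff_of_le fun i _ => hu i).1
      (le_antisymm (Finset.sum_le_sum fun i _ => hu i) hsum) i (Finset.mem_univ i)
  have hker : (1 - Pᵀ) *ᵥ (fun j => |u j|) = (1 - Pᵀ) *ᵥ 0 := by
    rw [sub_mulVec, one_mulVec, mulVec_zero, sub_eq_zero]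
    exact funext heq
  have habs := mulVec_injective_of_isUnit hinv hker
  exact funext fun i => abs_eq_zero.1 (congrFun habs i)

theorem idc_reduced_coefficient_matrix_invertible
    (K : ℕ) (hK : 0 < K)
    (P : Matrix (Fin K) (Fin K) ℝ)
    (hPnonneg : ∀ i j, 0 ≤ P i j)
    (hProw : ∀ i, ∑ j, P i j ≤ 1)
    (hInv : IsUnit (1 - Pᵀ))
    (lam0 : Fin K → ℝ) (hlam0 : ∀ i, 0 ≤ lam0 i)
    (lam : Fin K → ℝ) (hlam : lam = (1 - Pᵀ)⁻¹ *ᵥ lam0)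
    (hlampos : ∀ i, 0 < lam i)
    (w : Fin K → ℝ) (hw : ∀ i, 0 ≤ w i ∧ w i ≤ 1)
    (C : Matrix (Fin K) (Fin K) ℝ)
    (hC : ∀ i j, C i j = lam j * (P j i) ^ 2 * w j / lam i) :
    IsUnit (1 - C) := by
  rw [← mulVec_injective_iff_isUnit, ← coe_mulVecLin, injective_iff_map_eq_zero]
  intro v hv
  rw [mulVecLin_apply, sub_mulVec, one_mulVec, sub_eq_zero] at hv
  have hfix : ∀ i, lam i * v i = ∑ j, P j i ^ 2 * w j * (lam j * v j) := fun i => by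
    conv_lhs => rw [hv]
    simp only [mulVec, dotProduct, hC, Finset.mul_sum]
    refine Finset.sum_congr rfl fun j _ => ?_
    have := (hlampos i).ne'
    field_simp
  have hle : ∀ i j, P j i ^ 2 * w j ≤ P j i := fun i j => by
    have hP1 : P j i ≤ 1 :=
      (Finset.single_le_sum (fun k _ => hPnonneg j k) (Finset.mem_univ i)).trans (hProw j)
    calc P j i ^ 2 * w j ≤ P j i ^ 2 := mul_le_of_le_one_right (sq_nonneg _) (hw j).2
      _ ≤ P j i := pow_le_of_le_one (hPnonneg j i) hP1 two_ne_zero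
  have hzero : (fun i => lam i * v i) = 0 := by
    refine eq_zero_of_abs_le_transpose_mulVec_abs hProw hInv fun i => ?_
    rw [hfix i]
    refine (Finset.abs_sum_le_sum_abs _ _).trans (Finset.sum_le_sum fun j _ => ?_)
    rw [abs_mul, abs_of_nonneg (mul_nonneg (sq_nonneg (P j i)) (hw j).1)]
    exact mul_le_mul_of_nonneg_right (hle i j) (abs_nonneg _)
  exact funext fun i => (mul_eq_zero.1 (congrFun hzero i)).resolve_left (hlampos i).ne'
end

section
/- Let P be a K×K real matrix with nonnegative entries and row sums at most 1 (a substochastic matrix): P_{i,j} ≥ 0 and Σ_j P_{i,j} ≤ 1 for all i. Suppose that for every index i there exists a positive integer n such that Σ_j (Pⁿ)_{i,j} < 1 (every customer eventually leaves the network). Then the matrix powers Pⁿ converge entrywise to the zero matrix as n → ∞, and consequently I − P is invertible. -/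
open Matrix Filter

theorem norm_pow_antitone_of_norm_le_one {R : Type*} [NormedRing R] {a : R} (ha : ‖a‖ ≤ 1) :
    Antitone fun n : ℕ => ‖a ^ n‖ :=
  antitone_nat_of_succ_le fun n => by
    rw [pow_succ]
    exact (norm_mul_le _ _).trans (mul_le_of_le_one_right (norm_nonneg _) ha)

theorem tendsto_norm_pow_zero_of_norm_pow_lt_one {R : Type*} [NormedRing R] {a : R}
    (ha : ‖a‖ ≤ 1) {N : ℕ} (hN : N ≠ 0) (haN : ‖a ^ N‖ < 1) :
    Tendsto (fun n : ℕ => ‖a ^ n‖) atTop (nhds 0) := by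
  have h : Tendsto (fun n : ℕ => ‖(a ^ N) ^ (n / N)‖) atTop (nhds 0) :=
    (tendsto_zero_iff_norm_tendsto_zero.mp
      (tendsto_pow_atTop_nhds_zero_of_norm_lt_one haN)).comp (Nat.tendsto_div_const_atTop hN)
  refine squeeze_zero (fun n => norm_nonneg _) (fun n => ?_) h
  rw [← pow_mul]
  exact norm_pow_antitone_of_norm_le_one ha (Nat.mul_div_le n N)

theorem isUnit_one_sub_of_isUnit_one_sub_pow {R : Type*} [Ring R] {a : R} {N : ℕ}
    (h : IsUnit (1 - a ^ N)) : IsUnit (1 - a) := by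
  rw [← mul_neg_geom_sum] at h
  have hc : Commute (1 - a) (∑ i ∈ Finset.range N, a ^ i) :=
    (mul_neg_geom_sum a N).trans (geom_sum_mul_neg a N).symm
  exact (hc.isUnit_mul_iff.mp h).1

section LinftyOpNorm

attribute [local instance] Matrix.linftyOpNormedRing Matrix.linftyOpNormedAlgebra

theorem Matrix.norm_apply_le_linftyOpNorm {ι : Type*} [Fintype ι] [DecidableEq ι]
    (A : Matrix ι ι ℝ) (i j : ι) : ‖A i j‖ ≤ ‖A‖ := by
  rw [Matrix.linfty_opNorm_def, ← coe_nnnorm, NNReal.coe_le_coe]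
  exact (Finset.single_le_sum (f := fun j => ‖A i j‖₊) (fun _ _ => zero_le)
    (Finset.mem_univ j)).trans
    (Finset.le_sup (f := fun i => ∑ j, ‖A i j‖₊) (Finset.mem_univ i))

theorem Matrix.coe_sum_nnnorm_of_nonneg {ι : Type*} [Fintype ι]
    {A : Matrix ι ι ℝ} (hA : ∀ i j, 0 ≤ A i j) (i : ι) :
    ((∑ j, ‖A i j‖₊ : NNReal) : ℝ) = ∑ j, A i j := by
  push_cast
  exact Finset.sum_congr rfl fun j _ => Real.norm_of_nonneg (hA i j)

theorem Matrix.linftyOpNorm_le_one_of_row_sum_le {ι : Type*} [Fintype ι] [DecidableEq ι]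
    {A : Matrix ι ι ℝ} (hA : ∀ i j, 0 ≤ A i j) (h : ∀ i, ∑ j, A i j ≤ 1) : ‖A‖ ≤ 1 := by
  rw [Matrix.linfty_opNorm_def, ← NNReal.coe_one, NNReal.coe_le_coe]
  refine Finset.sup_le fun i _ => ?_
  rw [← NNReal.coe_le_coe, Matrix.coe_sum_nnnorm_of_nonneg hA]
  exact h i

theorem Matrix.linftyOpNorm_lt_one_of_row_sum_lt {ι : Type*} [Fintype ι] [DecidableEq ι]
    {A : Matrix ι ι ℝ} (hA : ∀ i j, 0 ≤ A i j) (h : ∀ i, ∑ j, A i j < 1) : ‖A‖ < 1 := by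
  rw [Matrix.linfty_opNorm_def, ← NNReal.coe_one, NNReal.coe_lt_coe]
  refine (Finset.sup_lt_iff (by simp)).mpr fun i _ => ?_
  rw [← NNReal.coe_lt_coe, Matrix.coe_sum_nnnorm_of_nonneg hA]
  exact h i

theorem Matrix.pow_apply_nonneg_of_nonneg {ι : Type*} [Fintype ι] [DecidableEq ι]
    {A : Matrix ι ι ℝ} (hA : ∀ i j, 0 ≤ A i j) (n : ℕ) : ∀ i j, 0 ≤ (A ^ n) i j := by
  induction n with
  | zero => intro i j; rw [pow_zero, Matrix.one_apply]; split_ifs <;> norm_num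
  | succ n ih =>
    intro i j
    rw [pow_succ, Matrix.mul_apply]
    exact Finset.sum_nonneg fun k _ => mul_nonneg (ih i k) (hA k j)

theorem Matrix.row_sum_pow_antitone {ι : Type*} [Fintype ι] [DecidableEq ι]
    {A : Matrix ι ι ℝ} (hA : ∀ i j, 0 ≤ A i j) (h : ∀ i, ∑ j, A i j ≤ 1) (i : ι) :
    Antitone fun n : ℕ => ∑ j, (A ^ n) i j :=
  antitone_nat_of_succ_le fun n => by
    simp only [pow_succ, Matrix.mul_apply]
    rw [Finset.sum_comm]
    refine Finset.sum_le_sum fun k _ => ?_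
    rw [← Finset.mul_sum]
    exact mul_le_of_le_one_right (Matrix.pow_apply_nonneg_of_nonneg hA n i k) (h k)

theorem Matrix.exists_linftyOpNorm_pow_lt_one {ι : Type*} [Fintype ι] [DecidableEq ι]
    {A : Matrix ι ι ℝ} (hA : ∀ i j, 0 ≤ A i j) (h : ∀ i, ∑ j, A i j ≤ 1)
    (hlt : ∀ i, ∃ n : ℕ, ∑ j, (A ^ n) i j < 1) : ∃ N : ℕ, N ≠ 0 ∧ ‖A ^ N‖ < 1 := by
  choose n hn using hlt
  refine ⟨Finset.univ.sup n + 1, Nat.succ_ne_zero _, Matrix.linftyOpNorm_lt_one_of_row_sum_lt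
    (Matrix.pow_apply_nonneg_of_nonneg hA _) fun i => ?_⟩
  exact (Matrix.row_sum_pow_antitone hA h i
    ((Finset.le_sup (Finset.mem_univ i)).trans (Nat.le_succ _))).trans_lt (hn i)

theorem Matrix.isUnit_one_sub_of_linftyOpNorm_lt_one {ι : Type*} [Fintype ι] [DecidableEq ι]
    {A : Matrix ι ι ℝ} (hA : ‖A‖ < 1) : IsUnit (1 - A) :=
  haveI : CompleteSpace (Matrix ι ι ℝ) := FiniteDimensional.complete ℝ _
  isUnit_one_sub_of_norm_lt_one hA

theorem Matrix.tendsto_pow_and_isUnit_of_substochastic {ι : Type*} [Fintype ι] [DecidableEq ι]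
    {A : Matrix ι ι ℝ} (hA : ∀ i j, 0 ≤ A i j) (h : ∀ i, ∑ j, A i j ≤ 1)
    (hlt : ∀ i, ∃ n : ℕ, ∑ j, (A ^ n) i j < 1) :
    (∀ i j, Tendsto (fun n => (A ^ n) i j) atTop (nhds 0)) ∧ IsUnit (1 - A) := by
  obtain ⟨N, hN, hAN⟩ := Matrix.exists_linftyOpNorm_pow_lt_one hA h hlt
  exact ⟨fun i j => squeeze_zero_norm (fun n => Matrix.norm_apply_le_linftyOpNorm (A ^ n) i j)
      (tendsto_norm_pow_zero_of_norm_pow_lt_one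
        (Matrix.linftyOpNorm_le_one_of_row_sum_le hA h) hN hAN),
    isUnit_one_sub_of_isUnit_one_sub_pow (Matrix.isUnit_one_sub_of_linftyOpNorm_lt_one hAN)⟩

end LinftyOpNorm

theorem substochastic_eventually_leaving_powers_tendsto_zero
    (K : ℕ) (P : Matrix (Fin K) (Fin K) ℝ)
    (hPnonneg : ∀ i j, 0 ≤ P i j)
    (hProw : ∀ i, ∑ j, P i j ≤ 1)
    (hleave : ∀ i, ∃ n : ℕ, 0 < n ∧ ∑ j, (P ^ n) i j < 1) :
    (∀ i j, Tendsto (fun n => (P ^ n) i j) atTop (nhds 0)) ∧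
      IsUnit (1 - P) :=
  Matrix.tendsto_pow_and_isUnit_of_substochastic hPnonneg hProw
    fun i => (hleave i).imp fun _ hn => hn.2
end

section
/- Let φ(x) = e^{−x²/2}/√(2π) be the standard normal density and Φ^c(x) = ∫_x^∞ φ(u) du the standard normal complementary cdf, and define the canonical weight function w*(t) = (1/(2t)) · ( (t² + 2t − 1)(1 − 2Φ^c(√t)) + 2φ(√t)·√t·(1 + t) − t² ) for t > 0. Then w* is monotonically increasing on (0,∞): for all 0 < s ≤ t, w*(s) ≤ w*(t). -/
open Real Filter

/-- The standard normal density. -/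
noncomputable def stdNormalPDF (x : ℝ) : ℝ := Real.exp (-x ^ 2 / 2) / Real.sqrt (2 * Real.pi)

/-- The standard normal complementary cdf. -/
noncomputable def stdNormalCCDF (x : ℝ) : ℝ := ∫ u in Set.Ioi x, stdNormalPDF u

/-- The canonical weight function `w*` from the departure IDC approximation. -/
noncomputable def canonicalWeight (t : ℝ) : ℝ :=
  (1 / (2 * t)) *
    ((t ^ 2 + 2 * t - 1) * (1 - 2 * stdNormalCCDF (Real.sqrt t)) +
      2 * stdNormalPDF (Real.sqrt t) * Real.sqrt t * (1 + t) - t ^ 2)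

theorem hasDerivAt_stdNormalPDF (x : ℝ) :
    HasDerivAt stdNormalPDF (-x * stdNormalPDF x) x := by
  have h : HasDerivAt (fun y : ℝ => -y ^ 2 / 2) (-x) x := by
    refine ((hasDerivAt_pow 2 x).neg.div_const 2).congr_deriv ?_
    simp
    ring
  refine (h.exp.div_const (Real.sqrt (2 * Real.pi))).congr_deriv ?_
  unfold stdNormalPDF
  ring

theorem stdNormalPDF_nonneg (x : ℝ) : 0 ≤ stdNormalPDF x := by
  unfold stdNormalPDF
  positivity

theorem continuous_stdNormalPDF : Continuous stdNormalPDF := by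
  unfold stdNormalPDF
  fun_prop

theorem integrable_stdNormalPDF : MeasureTheory.Integrable stdNormalPDF := by
  convert (integrable_exp_neg_mul_sq (b := 1 / 2) (by norm_num)).div_const
    (Real.sqrt (2 * Real.pi)) using 1
  ext x
  unfold stdNormalPDF
  ring_nf

theorem integrable_mul_stdNormalPDF :
    MeasureTheory.Integrable fun x => x * stdNormalPDF x := by
  convert (integrable_mul_exp_neg_mul_sq (b := 1 / 2) (by norm_num)).div_const
    (Real.sqrt (2 * Real.pi)) using 1
  ext x
  unfold stdNormalPDF
  ring_nf

theorem tendsto_stdNormalPDF_atTop : Tendsto stdNormalPDF atTop (nhds 0) := by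
  have h : Tendsto (fun x : ℝ => -x ^ 2 / 2) atTop atBot := by
    have := (tendsto_pow_atTop (α := ℝ) two_ne_zero).atTop_mul_const
      (show (0 : ℝ) < 1 / 2 by norm_num)
    refine (tendsto_neg_atTop_atBot.comp this).congr fun x => ?_
    simp only [Function.comp_apply]
    ring
  rw [← zero_div (Real.sqrt (2 * Real.pi))]
  exact (Real.tendsto_exp_atBot.comp h).div_const _

theorem stdNormalCCDF_zero : stdNormalCCDF 0 = 1 / 2 := by
  have h := integral_gaussian_Ioi (1 / 2)
  have e : stdNormalCCDF 0 =
      (∫ u in Set.Ioi (0 : ℝ), Real.exp (-(1 / 2) * u ^ 2)) / Real.sqrt (2 * Real.pi) := by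
    rw [stdNormalCCDF, ← MeasureTheory.integral_div]
    congr 1
    ext u
    unfold stdNormalPDF
    ring_nf
  rw [e, h, show Real.pi / (1 / 2) = 2 * Real.pi by ring]
  have : 0 < Real.sqrt (2 * Real.pi) := by positivity
  field_simp

theorem hasDerivAt_stdNormalCCDF (x : ℝ) :
    HasDerivAt stdNormalCCDF (-stdNormalPDF x) x := by
  have e : stdNormalCCDF = fun y => stdNormalCCDF 0 - ∫ u in (0 : ℝ)..y, stdNormalPDF u := by
    ext y
    have := intervalIntegral.integral_interval_add_Ioi (a := 0) (b := y) (f := stdNormalPDF)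
      (μ := MeasureTheory.volume) integrable_stdNormalPDF.integrableOn
      integrable_stdNormalPDF.integrableOn
    unfold stdNormalCCDF
    linarith
  rw [e]
  exact (continuous_stdNormalPDF.integral_hasStrictDerivAt 0 x).hasDerivAt.const_sub _

/-- The Gaussian Mills ratio bound. -/
theorem mul_stdNormalCCDF_le_stdNormalPDF (x : ℝ) :
    x * stdNormalCCDF x ≤ stdNormalPDF x := by
  have h : ∫ u in Set.Ioi x, u * stdNormalPDF u = stdNormalPDF x := by
    have := MeasureTheory.integral_Ioi_of_hasDerivAt_of_tendsto' (a := x)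
      (f := fun u => -stdNormalPDF u) (f' := fun u => u * stdNormalPDF u) (m := 0)
      (fun u _ => (hasDerivAt_stdNormalPDF u).neg.congr_deriv (by ring))
      integrable_mul_stdNormalPDF.integrableOn
      (by simpa using tendsto_stdNormalPDF_atTop.neg)
    simpa using this
  rw [← h, stdNormalCCDF, ← MeasureTheory.integral_const_mul]
  refine MeasureTheory.setIntegral_mono_on (integrable_stdNormalPDF.const_mul x).integrableOn
    integrable_mul_stdNormalPDF.integrableOn measurableSet_Ioi fun u hu => ?_
  exact mul_le_mul_of_nonneg_right (le_of_lt hu) (stdNormalPDF_nonneg u)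

theorem stdNormal_combination_nonneg {x : ℝ} (hx : 0 ≤ x) :
    0 ≤ 1 - 2 * ((1 + x ^ 4) * stdNormalCCDF x) + 2 * (stdNormalPDF x * (x ^ 3 - x)) := by
  let G : ℝ → ℝ := fun x =>
    1 - 2 * ((1 + x ^ 4) * stdNormalCCDF x) + 2 * (stdNormalPDF x * (x ^ 3 - x))
  have hG (y : ℝ) :
      HasDerivAt G (8 * y ^ 2 * (stdNormalPDF y - y * stdNormalCCDF y)) y := by
    have h₁ := (((hasDerivAt_pow 4 y).const_add 1).mul (hasDerivAt_stdNormalCCDF y)).const_mul 2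
    have h₂ := ((hasDerivAt_stdNormalPDF y).mul
      ((hasDerivAt_pow 3 y).sub (hasDerivAt_id y))).const_mul 2
    refine ((h₁.const_sub 1).add h₂).congr_deriv ?_
    simp
    ring
  have hmono : Monotone G := monotone_of_hasDerivAt_nonneg hG fun y =>
    mul_nonneg (by positivity) (sub_nonneg.mpr (mul_stdNormalCCDF_le_stdNormalPDF y))
  have h := hmono hx
  have h0 : G 0 = 0 := by simp [G, stdNormalCCDF_zero]
  rwa [h0] at h

theorem hasDerivAt_canonicalWeight_sq {x : ℝ} (hx : 0 < x) :
    HasDerivAt (fun y => canonicalWeight (y ^ 2))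
      ((1 - 2 * ((1 + x ^ 4) * stdNormalCCDF x) + 2 * (stdNormalPDF x * (x ^ 3 - x))) / x ^ 3)
      x := by
  have h2 := hasDerivAt_pow 2 x
  have h₁ := (((h2.pow 2).add (h2.const_mul 2)).sub_const 1).mul
    (((hasDerivAt_stdNormalCCDF x).const_mul 2).const_sub 1)
  have h₂ := (((hasDerivAt_stdNormalPDF x).const_mul 2).mul (hasDerivAt_id x)).mul
    (h2.const_add 1)
  have h := (((h₁.add h₂).sub (h2.pow 2)).div (h2.const_mul 2) (by positivity))
  refine HasDerivAt.congr_of_eventuallyEq (h.congr_deriv ?_) ?_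
  · simp
    field_simp
    ring
  · filter_upwards [lt_mem_nhds hx] with y hy
    simp [canonicalWeight, Real.sqrt_sq hy.le]
    field_simp

/-- `w*` is monotonically increasing on `(0, ∞)`. -/
theorem canonicalWeight_monotoneOn :
    ∀ s t : ℝ, 0 < s → s ≤ t → canonicalWeight s ≤ canonicalWeight t := by
  intro s t hs hst
  have hmono : MonotoneOn (fun y => canonicalWeight (y ^ 2)) (Set.Ioi 0) := by
    refine monotoneOn_of_hasDerivWithinAt_nonneg (convex_Ioi 0)
      (fun x hx => (hasDerivAt_canonicalWeight_sq hx).continuousAt.continuousWithinAt)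
      (fun x hx => (hasDerivAt_canonicalWeight_sq (interior_subset hx)).hasDerivWithinAt)
      fun x hx => ?_
    have hx' : 0 < x := interior_subset hx
    exact div_nonneg (stdNormal_combination_nonneg hx'.le) (by positivity)
  have ht := hs.trans_le hst
  simpa [Real.sq_sqrt hs.le, Real.sq_sqrt ht.le] using
    hmono (Real.sqrt_pos.mpr hs) (Real.sqrt_pos.mpr ht) (Real.sqrt_le_sqrt hst)
end
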